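/- Let p be an odd prime and let k ≥ 1 be an integer. The group cohomology of G = ℤ/p × ℤ/p in degree 2k+1 with coefficients in ℤ regarded as a trivial G-module is isomorphic, as an abelian group, to (ℤ/p)^{k}. -/

import Mathlib

set_option linter.unusedSectionVars false
namespace ZpZp

theorem zigzag {M : Type} [AddCommGroup M] (α β : ℕ → M →ₗ[ℤ] M)
    (hcomm : ∀ i j m, α i (β j m) = β j (α i m))
    (hβ : ∀ i m, β i (β (i+1) m) = 0)
    (hex : ∀ i m, 1 ≤ i → α i m = 0 → ∃ m', α (i+1) m' = m)
    (n : ℕ) (x : ℕ → M)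
    (hx : ∀ i, i < n → α (i+1) (x (i+1)) + (-1 : ℤ)^i • β (n-i) (x i) = 0)
    (h0 : ∃ y0 y1, α 1 y1 + β (n+1) y0 = x 0) :
    ∃ y : ℕ → M, ∀ i, i ≤ n → α (i+1) (y (i+1)) + (-1 : ℤ)^i • β (n+1-i) (y i) = x i := by
  classical
  obtain ⟨y0, y1, h01⟩ := h0
  have hex' : ∀ i m, ∃ m', (1 ≤ i → α i m = 0 → α (i+1) m' = m) := by
    intro i m
    by_cases h : 1 ≤ i ∧ α i m = 0
    · obtain ⟨m', hm⟩ := hex i m h.1 h.2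
      exact ⟨m', fun _ _ => hm⟩
    · exact ⟨0, fun a b => absurd ⟨a, b⟩ h⟩
  choose c hc using hex'
  let y : ℕ → M := fun i => Nat.rec y0
    (fun i yi => if i = 0 then y1 else c i (x i - (-1 : ℤ)^i • β (n+1-i) yi)) i
  have hy0 : y 0 = y0 := rfl
  have hy1 : y 1 = y1 := rfl
  have hys : ∀ i, y (i+2) = c (i+1) (x (i+1) - (-1 : ℤ)^(i+1) • β (n+1-(i+1)) (y (i+1))) :=
    fun i => rfl
  refine ⟨y, fun i => ?_⟩
  induction i with
  | zero => intro _; simpa [hy0, hy1] using h01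
  | succ i ih =>
    intro hi
    have h1 := ih (by omega)
    have h2 := hx i (by omega)
    rw [hys, hc]
    · abel
    · omega
    · have e1 : n + 1 - (i+1) = n - i := by omega
      have e2 : n + 1 - i = (n - i) + 1 := by omega
      rw [e1, map_sub, map_smul, hcomm]
      rw [← h1, e2] at h2
      simp only [map_add, map_smul, hβ, smul_zero, add_zero] at h2
      rw [← h2, pow_succ]
      module

section ops
variable (p : ℕ) [NeZero p]

abbrev F := ZMod p × ZMod p → ℤ

def S : F p →ₗ[ℤ] F p where
  toFun x h := x (h.1 - 1, h.2) - x h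
  map_add' x y := by ext h; simp; ring
  map_smul' x y := by ext h; simp; ring
def N : F p →ₗ[ℤ] F p where
  toFun x h := ∑ w, x (w, h.2)
  map_add' x y := by ext h; simp [Finset.sum_add_distrib]
  map_smul' x y := by ext h; simp [Finset.mul_sum]
def S' : F p →ₗ[ℤ] F p where
  toFun x h := x (h.1, h.2 - 1) - x h
  map_add' x y := by ext h; simp; ring
  map_smul' x y := by ext h; simp; ring
def N' : F p →ₗ[ℤ] F p where
  toFun x h := ∑ w, x (h.1, w)
  map_add' x y := by ext h; simp [Finset.sum_add_distrib]
  map_smul' x y := by ext h; simp [Finset.mul_sum]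
def R : F p →ₗ[ℤ] F p where
  toFun x h := if h.1 = 0 then x h else 0
  map_add' x y := by ext h; simp; split <;> simp
  map_smul' x y := by ext h; simp
def α (i : ℕ) : F p →ₗ[ℤ] F p := if Odd i then S p else N p
def β (i : ℕ) : F p →ₗ[ℤ] F p := if Odd i then S' p else N' p

variable {p}
theorem S_apply (x : F p) (h) : S p x h = x (h.1 - 1, h.2) - x h := rfl
theorem N_apply (x : F p) (h) : N p x h = ∑ w, x (w, h.2) := rfl
theorem S'_apply (x : F p) (h) : S' p x h = x (h.1, h.2 - 1) - x h := rfl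
theorem N'_apply (x : F p) (h) : N' p x h = ∑ w, x (h.1, w) := rfl
theorem R_apply (x : F p) (h) : R p x h = if h.1 = 0 then x h else 0 := rfl

theorem sum_shift (f : ZMod p → ℤ) : ∑ w, f (w - 1) = ∑ w, f w :=
  Fintype.sum_equiv (Equiv.subRight 1) _ _ (fun _ => rfl)

theorem NS (x : F p) : N p (S p x) = 0 := by
  ext h; simp [N_apply, S_apply, sum_shift (fun w => x (w, h.2))]
theorem SN (x : F p) : S p (N p x) = 0 := by
  ext h; simp [N_apply, S_apply]
theorem N'S' (x : F p) : N' p (S' p x) = 0 := by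
  ext h; simp [N'_apply, S'_apply, sum_shift (fun w => x (h.1, w))]
theorem S'N' (x : F p) : S' p (N' p x) = 0 := by
  ext h; simp [N'_apply, S'_apply]

theorem comm1 (x : F p) : S p (S' p x) = S' p (S p x) := by
  ext h; simp [S_apply, S'_apply]; ring
theorem comm2 (x : F p) : S p (N' p x) = N' p (S p x) := by
  ext h; simp [S_apply, N'_apply]
theorem comm3 (x : F p) : N p (S' p x) = S' p (N p x) := by
  ext h; simp [N_apply, S'_apply]
theorem comm4 (x : F p) : N p (N' p x) = N' p (N p x) := by
  ext h; simp [N_apply, N'_apply]; exact Finset.sum_comm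
theorem commR1 (x : F p) : R p (S' p x) = S' p (R p x) := by
  ext h; simp [R_apply, S'_apply]; split <;> simp
theorem commR2 (x : F p) : R p (N' p x) = N' p (R p x) := by
  ext h; simp [R_apply, N'_apply]; split <;> simp

theorem αβ (i j) (x : F p) : α p i (β p j x) = β p j (α p i x) := by
  unfold α β; split <;> split <;> simp [comm1, comm2, comm3, comm4]
theorem Rβ (j) (x : F p) : R p (β p j x) = β p j (R p x) := by
  unfold β; split <;> simp [commR1, commR2]
theorem αα (i) (x : F p) : α p i (α p (i+1) x) = 0 := by
  unfold α
  by_cases h : Odd i <;> simp [h, Nat.odd_add_one, SN, NS]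
theorem ββ (i) (x : F p) : β p i (β p (i+1) x) = 0 := by
  unfold β
  by_cases h : Odd i <;> simp [h, Nat.odd_add_one, S'N', N'S']

theorem const_of_shift (f : ZMod p → ℤ) (h : ∀ u, f (u - 1) = f u) (u) : f u = f 0 := by
  have : ∀ n : ℕ, f (n : ZMod p) = f 0 := by
    intro n; induction n with
    | zero => simp
    | succ n ih => rw [← ih, ← h]; simp
  rw [← this u.val]; simp

theorem exists_of_sum_zero (f : ZMod p → ℤ) (h : ∑ u, f u = 0) :
    ∃ g : ZMod p → ℤ, ∀ u, g (u - 1) - g u = f u := by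
  have hs : ∑ i ∈ Finset.range p, f (i : ZMod p) = 0 := by
    rw [← h]
    refine Finset.sum_bij (fun i _ => (i : ZMod p)) (by simp) ?_ ?_ (by simp)
    · intro a ha b hb hab
      rw [ZMod.natCast_eq_natCast_iff'] at hab
      simp at ha hb
      rwa [Nat.mod_eq_of_lt ha, Nat.mod_eq_of_lt hb] at hab
    · intro b _
      exact ⟨b.val, by simp [ZMod.val_lt], by simp⟩
  let G : ℕ → ℤ := fun n => ∑ i ∈ Finset.range (n+1), f (i : ZMod p)
  refine ⟨fun u => - G u.val, fun u => ?_⟩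
  by_cases hu : u = 0
  · subst hu
    obtain ⟨q, rfl⟩ : ∃ q, p = q + 1 := ⟨p - 1, by have := NeZero.pos p; omega⟩
    have : ((0 : ZMod (q+1)) - 1).val = q := by simp [ZMod.val_neg_one]
    simp only [this]
    simp [G, hs]
  · have h1 : (u - 1).val + 1 = u.val := by
      have : 1 < p := by
        by_contra hh
        have : p = 1 := by have := NeZero.pos p; omega
        subst this
        exact hu (Subsingleton.elim _ _)
      have : Fact (1 < p) := ⟨this⟩
      have hpos : 1 ≤ u.val := Nat.one_le_iff_ne_zero.2 (by simpa using hu)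
      rw [ZMod.val_sub (by rw [ZMod.val_one]; exact hpos), ZMod.val_one]; omega
    simp only [G, ← h1]
    rw [Finset.sum_range_succ _ ((u-1).val + 1)]
    have : (((u-1).val + 1 : ℕ) : ZMod p) = u := by rw [h1]; simp
    rw [this]; ring

theorem ker_N (x : F p) (h : N p x = 0) : ∃ y, S p y = x := by
  have : ∀ v, ∃ g : ZMod p → ℤ, ∀ u, g (u - 1) - g u = x (u, v) := fun v =>
    exists_of_sum_zero (fun u => x (u, v)) (by simpa [N_apply] using congrFun h (0, v))
  choose g hg using this
  exact ⟨fun h => g h.2 h.1, by ext h; simp [S_apply, hg]⟩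
theorem ker_N' (x : F p) (h : N' p x = 0) : ∃ y, S' p y = x := by
  have : ∀ v, ∃ g : ZMod p → ℤ, ∀ u, g (u - 1) - g u = x (v, u) := fun v =>
    exists_of_sum_zero (fun u => x (v, u)) (by simpa [N'_apply] using congrFun h (v, 0))
  choose g hg using this
  exact ⟨fun h => g h.1 h.2, by ext h; simp [S'_apply, hg]⟩
theorem ker_S (x : F p) (h : S p x = 0) : N p (R p x) = x := by
  ext ⟨u, v⟩
  simp [N_apply, R_apply]
  refine (const_of_shift (fun u => x (u, v)) (fun u => ?_) u).symm
  have := congrFun h (u, v)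
  simpa [S_apply, sub_eq_zero] using this
theorem ker_S' (x : F p) (h : S' p x = 0) : ∃ y, N' p y = x := by
  refine ⟨fun h => if h.2 = 0 then x h else 0, ?_⟩
  ext ⟨u, v⟩
  simp [N'_apply]
  refine (const_of_shift (fun v => x (u, v)) (fun v => ?_) v).symm
  have := congrFun h (u, v)
  simpa [S'_apply, sub_eq_zero] using this

theorem ex_α (i) (x : F p) (h : α p i x = 0) : ∃ y, α p (i+1) y = x := by
  by_cases hi : Odd i
  · simp only [α, hi, Nat.odd_add_one, if_true, not_true, if_false] at h ⊢
    exact ⟨_, ker_S x h⟩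
  · simp only [α, hi, Nat.odd_add_one, if_false, not_false_iff, if_true] at h ⊢
    exact ker_N x h
theorem ex_β (i) (x : F p) (h : β p i x = 0) : ∃ y, β p (i+1) y = x := by
  by_cases hi : Odd i
  · simp only [β, hi, Nat.odd_add_one, if_true, not_true, if_false] at h ⊢
    exact ker_S' x h
  · simp only [β, hi, Nat.odd_add_one, if_false, not_false_iff, if_true] at h ⊢
    exact ker_N' x h

theorem start (n : ℕ) (x : F p) (h : β p n (N p x) = 0) :
    ∃ y0 y1, α p 1 y1 + β p (n+1) y0 = x := by
  obtain ⟨m, hm⟩ := ex_β n _ h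
  have hN : ∀ j y, N p (β p j y) = β p j (N p y) := fun j y => by
    simpa [α] using αβ 0 j y
  have : N p (x - β p (n+1) (R p m)) = 0 := by
    rw [map_sub, ← Rβ, hm, ker_S _ (SN x), sub_self]
  obtain ⟨y, hy⟩ := ker_N _ this
  exact ⟨R p m, y, by simp [α, hy]⟩

theorem exact_succ (n : ℕ) (x : ℕ → F p)
    (hx : ∀ i, i < n+1 → α p (i+1) (x (i+1)) + (-1 : ℤ)^i • β p (n+1-i) (x i) = 0) :
    ∃ y : ℕ → F p, ∀ i, i ≤ n+1 →
      α p (i+1) (y (i+1)) + (-1 : ℤ)^i • β p (n+1+1-i) (y i) = x i := by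
  refine zigzag (α p) (β p) αβ ββ (fun i m _ h => ex_α i m h) (n+1) x hx (start _ _ ?_)
  have h0 := hx 0 (by omega)
  have := αβ 0 (n+1) (x 0)
  have h2 := congrArg (α p 0) h0
  simp [αα] at h2
  rw [αβ] at h2
  simpa [α] using h2

theorem exact_zero (x : F p) (hx : ∑ h, x h = 0) :
    ∃ y0 y1, α p 1 y1 + β p 1 y0 = x := by
  refine start 0 x ?_
  ext h
  simp [β, N_apply, N'_apply]
  rw [← hx, Fintype.sum_prod_type, Finset.sum_comm]

end ops

section rep
open CategoryTheory
variable (p : ℕ) [NeZero p]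

abbrev G := Multiplicative (ZMod p × ZMod p)

def rho (n : ℕ) : Representation ℤ (G p) (Fin (n+1) → F p) where
  toFun g :=
    { toFun := fun x i h => x i (h - g.toAdd)
      map_add' := fun x y => rfl
      map_smul' := fun x y => rfl }
  map_one' := by ext x i h; simp
  map_mul' g g' := by
    refine LinearMap.ext fun x => ?_
    ext i h
    simp [sub_sub]

noncomputable abbrev X (n : ℕ) : Rep ℤ (G p) := Rep.of (rho p n)

variable {p}
theorem rho_apply (n g x i h) : rho p n g x i h = x i (h - g.toAdd) := rfl

/-- translation -/
def tr (g : ZMod p × ZMod p) (x : F p) : F p := fun h => x (h - g)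
theorem rho_eq (n g x i) : rho p n g x i = tr g.toAdd (x i) := rfl
theorem tr_add (g) (x y : F p) : tr g (x + y) = tr g x + tr g y := rfl
theorem tr_smul (g) (c : ℤ) (y : F p) : tr g (c • y) = c • tr g y := rfl

theorem sum_shift' (f : ZMod p → ℤ) (a) : ∑ w, f (w - a) = ∑ w, f w :=
  Fintype.sum_equiv (Equiv.subRight a) _ _ (fun _ => rfl)

theorem α_tr (i g) (x : F p) : α p i (tr g x) = tr g (α p i x) := by
  unfold α; split
  · ext h; simp [tr, S_apply, sub_right_comm, Prod.sub_def]
  · ext h; simp [tr, N_apply, Prod.sub_def, sum_shift' (fun w => x (w, h.2 - g.2))]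
theorem β_tr (i g) (x : F p) : β p i (tr g x) = tr g (β p i x) := by
  unfold β; split
  · ext h; simp [tr, S'_apply, sub_right_comm, Prod.sub_def]
  · ext h; simp [tr, N'_apply, Prod.sub_def, sum_shift' (fun w => x (h.1 - g.1, w))]

variable (p) in
def dl (n : ℕ) : (Fin (n+2) → F p) →ₗ[ℤ] (Fin (n+1) → F p) where
  toFun x i := α p (i+1) (x i.succ) + (-1 : ℤ)^(i : ℕ) • β p (n+1-i) (x i.castSucc)
  map_add' x y := by
    refine funext fun i => ?_
    simp only [Pi.add_apply, map_add, smul_add]; abel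
  map_smul' c x := by
    refine funext fun i => ?_
    simp only [Pi.smul_apply, map_smul, smul_add, RingHom.id_apply]
    rw [smul_comm]

theorem dl_apply (n x i) : dl p n x i =
  α p (i+1) (x i.succ) + (-1 : ℤ)^(i : ℕ) • β p (n+1-i) (x i.castSucc) := rfl

theorem dl_dl (n x) : dl p n (dl p (n+1) x) = 0 := by
  refine funext fun i => ?_
  simp only [dl_apply, map_add, map_smul, Fin.val_succ, Fin.val_castSucc, αα, αβ]
  have e1 : n + 1 + 1 - i = (n + 1 - i) + 1 := by have := i.2; omega
  have e2 : n + 1 + 1 - (i + 1) = (n + 1 - i) := by have := i.2; omega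
  rw [e1, e2, ββ, Fin.succ_castSucc, pow_succ]
  simp

variable (p) in
def epsl : (Fin 1 → F p) →ₗ[ℤ] ℤ where
  toFun x := ∑ h, x 0 h
  map_add' x y := by simp [Finset.sum_add_distrib]
  map_smul' c x := by simp [Finset.mul_sum]
theorem epsl_apply (x) : epsl p x = ∑ h, x 0 h := rfl

theorem sumα1 (x : F p) : ∑ h, α p 1 x h = 0 := by
  have := NS x
  rw [Fintype.sum_prod_type_right]
  refine Finset.sum_eq_zero fun v _ => ?_
  simpa [α, N_apply] using congrFun this (0, v)
theorem sumβ1 (x : F p) : ∑ h, β p 1 x h = 0 := by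
  have := N'S' x
  rw [Fintype.sum_prod_type]
  refine Finset.sum_eq_zero fun v _ => ?_
  simpa [β, N'_apply] using congrFun this (v, 0)

theorem epsl_dl (x) : epsl p (dl p 0 x) = 0 := by
  simp [epsl_apply, dl_apply, Finset.sum_add_distrib, sumα1, sumβ1]

theorem dl_exact (n x) (hx : dl p n x = 0) : ∃ y, dl p (n+1) y = x := by
  obtain ⟨y, hy⟩ := exact_succ n (fun i => if h : i < n + 2 then x ⟨i, h⟩ else 0) (by
    intro i hi
    have := congrFun hx ⟨i, hi⟩
    simp only [dl_apply] at this
    rw [dif_pos (by omega), dif_pos (by omega)]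
    exact this)
  refine ⟨fun i => y i, funext fun i => ?_⟩
  have := hy i (by have := i.2; omega)
  simpa [dl_apply] using this

theorem epsl_exact (x) (hx : epsl p x = 0) : ∃ y, dl p 0 y = x := by
  obtain ⟨y0, y1, h⟩ := exact_zero (x 0) hx
  refine ⟨![y0, y1], funext fun i => ?_⟩
  have : i = 0 := Fin.fin_one_eq_zero i
  subst this
  simp [dl_apply, h]

variable (p) in
noncomputable def d (n : ℕ) : X p (n+1) ⟶ X p n := Rep.ofHom
  ⟨dl p n, fun g => by
    refine LinearMap.ext fun x => funext fun i => ?_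
    simp only [LinearMap.comp_apply, dl_apply, rho_eq, α_tr, β_tr, tr_add, tr_smul]⟩

variable (p) in
noncomputable def eps : X p 0 ⟶ Rep.trivial ℤ (G p) ℤ := Rep.ofHom
  ⟨epsl p, fun g => by
    refine LinearMap.ext fun x => ?_
    exact Fintype.sum_equiv (Equiv.subRight g.toAdd) _ _ (fun _ => rfl)⟩

theorem d_hom_apply (n x) : (d p n).hom x = dl p n x := rfl
theorem eps_hom_apply (x) : (eps p).hom x = epsl p x := rfl

variable (p) in
noncomputable def cx : ChainComplex (Rep ℤ (G p)) ℕ :=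
  ChainComplex.of (X p) (d p) (fun n => by
    apply Rep.hom_ext
    exact Representation.IntertwiningMap.ext (LinearMap.ext fun x => dl_dl (p := p) n x))

theorem cx_d (n) : (cx p).d (n+1) n = d p n := ChainComplex.of_d _ _ _

variable (p) in
noncomputable def pi : cx p ⟶ (ChainComplex.single₀ (Rep ℤ (G p))).obj (Rep.trivial ℤ (G p) ℤ) :=
  ((cx p).toSingle₀Equiv _).symm ⟨eps p, by
    rw [cx_d]
    ext x
    exact epsl_dl x⟩

theorem exact_of {k G : Type} [CommRing k] [Group G] (A B C : Rep.{0} k G) (f : A ⟶ B) (g : B ⟶ C) (w : f ≫ g = 0)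
    (h : ∀ x, g.hom x = 0 → ∃ y, f.hom y = x) : (ShortComplex.mk f g w).Exact := by
  apply (forget₂ (Rep.{0} k G) (ModuleCat.{0} k)).reflects_exact_of_faithful
  rw [ShortComplex.moduleCat_exact_iff]
  exact h

theorem pi_qi : QuasiIso (pi p) where
  quasiIsoAt m := by
    cases m with
    | zero =>
      rw [ChainComplex.quasiIsoAt₀_iff, ShortComplex.quasiIso_iff_of_zeros' _ rfl rfl rfl]
      constructor
      · refine exact_of _ _ _ _ _ _ fun x hx => ?_
        have hx' : epsl p x = 0 := hx
        obtain ⟨y, hy⟩ := epsl_exact x hx'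
        refine ⟨y, ?_⟩
        exact (congrArg (fun f => f.hom y) (cx_d (p := p) 0)).trans hy
      · rw [Rep.epi_iff_surjective]
        intro c
        refine ⟨fun _ => Pi.single 0 c, ?_⟩
        refine Eq.trans (b := epsl p (fun _ => Pi.single 0 c)) rfl ?_
        rw [epsl_apply]; exact Finset.sum_pi_single' 0 c _ |>.trans (by simp)
    | succ m =>
      rw [quasiIsoAt_iff_exactAt' (hL := ChainComplex.exactAt_succ_single_obj ..),
          HomologicalComplex.exactAt_iff' _ (m + 2) (m + 1) m (by simp) (by simp)]
      refine exact_of _ _ _ _ _ _ fun x hx => ?_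
      have hx' : dl p m x = 0 := (congrArg (fun f => f.hom x) (cx_d (p := p) m)).symm.trans hx
      obtain ⟨y, hy⟩ := dl_exact m x hx'
      exact ⟨y, (congrArg (fun f => f.hom y) (cx_d (p := p) (m+1))).trans hy⟩

theorem X_proj (n : ℕ) : Projective (X p n) := by
  let e : (Fin (n+1) →₀ MonoidAlgebra ℤ (G p)) ≃ₗ[ℤ] (Fin (n+1) → F p) :=
    Finsupp.linearEquivFunOnFinite ℤ _ _ ≪≫ₗ
      LinearEquiv.piCongrRight fun _ => MonoidAlgebra.coeffLinearEquiv ℤ ≪≫ₗ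
        Finsupp.linearEquivFunOnFinite ℤ ℤ (G p)
  have he : ∀ x i h, e x i h = (x i).coeff (Multiplicative.ofAdd h) := fun _ _ _ => rfl
  refine Projective.of_iso (P := Rep.free ℤ (G p) (Fin (n+1))) (Rep.mkIso ?_) inferInstance
  refine Representation.Equiv.mk e ?_
  intro g
  refine LinearMap.ext fun x => ?_
  ext i h
  simp only [LinearMap.comp_apply, rho_apply, LinearEquiv.coe_coe, he]
  have : (Representation.free ℤ (G p) (Fin (n + 1)) g x) i =
    Representation.ofMulAction ℤ (G p) (G p) g (x i) := by
    induction x using Finsupp.induction_linear with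
    | zero => simp
    | add a b ha hb => simp only [map_add, Finsupp.add_apply, ha, hb]
    | single j m =>
      rw [Representation.finsupp_single]
      by_cases hj : j = i
      · subst hj; simp
      · simp [Finsupp.single_eq_of_ne (Ne.symm hj)]
  rw [this]
  rw [Representation.coeff_ofMulAction]
  congr 1
  exact neg_add_eq_sub g.toAdd h

variable (p) in
noncomputable def res : ProjectiveResolution (Rep.trivial ℤ (G p) ℤ) where
  complex := cx p
  projective := X_proj
  π := pi p
  quasiIso := pi_qi

end rep

section coh
open CategoryTheory
variable {p : ℕ} [NeZero p]

variable (p) in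
abbrev Tr : Rep.{0} ℤ (G p) := Rep.trivial ℤ (G p) ℤ

def gen (n : ℕ) (j : Fin (n+1)) : Fin (n+1) → F p := Pi.single j (Pi.single 0 1)

theorem gen_sum (n j i) : ∑ h, gen (p := p) n j i h = if i = j then 1 else 0 := by
  unfold gen
  by_cases h : i = j
  · subst h; simp
  · simp [h]

noncomputable def co {n : ℕ} (f : X p n ⟶ Tr p) (j : ℕ) : ℤ :=
  if h : j < n + 1 then f.hom (gen n ⟨j, h⟩) else 0

noncomputable def hm (n : ℕ) (c : ℕ → ℤ) : X p n ⟶ Tr p := Rep.ofHom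
  ⟨{ toFun := fun x => ∑ i : Fin (n+1), (∑ h, x i h) * c i
     map_add' := fun x y => by simp [Finset.sum_add_distrib, add_mul]
     map_smul' := fun r x => by
      simp only [Pi.smul_apply, smul_eq_mul, ← Finset.mul_sum, mul_assoc, RingHom.id_apply] }, 
    fun g => by
      refine LinearMap.ext fun x => ?_
      change (∑ i : Fin (n+1), (∑ h, rho p n g x i h) * c i) =
        (∑ i : Fin (n+1), (∑ h, x i h) * c i)
      refine Finset.sum_congr rfl fun i _ => ?_
      congr 1
      exact Fintype.sum_equiv (Equiv.subRight g.toAdd) _ _ (fun _ => rfl)⟩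

theorem hm_apply (n c x) : (hm (p := p) n c).hom x = ∑ i : Fin (n+1), (∑ h, x i h) * c i := rfl

theorem hom_inv {n : ℕ} (f : X p n ⟶ Tr p) (g : G p) (x : Fin (n+1) → F p) :
    f.hom (rho p n g x) = f.hom x := 
  LinearMap.congr_fun (f.hom.isIntertwining' g) x

theorem hom_apply {n : ℕ} (f : X p n ⟶ Tr p) (x : Fin (n+1) → F p) :
    f.hom x = ∑ i : Fin (n+1), (∑ h, x i h) * co f i := by
  let L : (Fin (n+1) → F p) →ₗ[ℤ] ℤ := f.hom.toLinearMap
  have hL : ∀ x, L x = f.hom x := fun _ => rfl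
  rw [← hL]
  have hx : x = ∑ i, ∑ h, x i h • rho p n (Multiplicative.ofAdd h) (gen n i) := by
    ext j h
    simp only [Finset.sum_apply, Pi.smul_apply, rho_apply, gen, toAdd_ofAdd]
    rw [Finset.sum_eq_single j, Finset.sum_eq_single h]
    · simp
    · intro b _ hb
      have : h - b ≠ 0 := sub_ne_zero.2 hb.symm
      simp [Pi.single_eq_of_ne this]
    · simp
    · intro b _ hb
      simp [Pi.single_eq_of_ne hb.symm]
    · simp
  conv_lhs => rw [hx]
  rw [map_sum]
  refine Finset.sum_congr rfl fun i _ => ?_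
  rw [map_sum, Finset.sum_mul]
  refine Finset.sum_congr rfl fun h _ => ?_
  rw [map_smul, hL, hom_inv]
  have hi : (i : ℕ) < n + 1 := i.2
  rw [co, dif_pos hi]; simp

theorem hom_ext_co {n : ℕ} (f g : X p n ⟶ Tr p) (h : ∀ j, j ≤ n → co f j = co g j) : f = g := by
  apply Rep.hom_ext
  refine Representation.IntertwiningMap.ext (LinearMap.ext fun x => ?_)
  refine (hom_apply f x).trans ((hom_apply g x).trans ?_).symm
  refine Finset.sum_congr rfl fun i _ => ?_
  rw [h i (by have := i.2; omega)]

theorem co_hm {n : ℕ} (c : ℕ → ℤ) (j : ℕ) (hj : j ≤ n) : co (hm (p := p) n c) j = c j := by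
  rw [co, dif_pos (by omega), hm_apply]
  simp only [gen_sum]
  simp

variable (p) in
def a (j : ℕ) : ℤ := if Odd j ∨ j = 0 then 0 else p

theorem sumα (m : ℕ) (x : F p) : ∑ h, α p (m+1) x h = a p (m+1) * ∑ h, x h := by
  by_cases hm : Odd (m+1)
  · have := sumα1 x
    simp only [α, odd_one, if_true] at this
    simp [α, a, hm, this]
  · simp only [α, a, hm, if_false, N_apply]
    rw [Fintype.sum_prod_type, Fintype.sum_prod_type_right]
    simp
theorem sumβ (m : ℕ) (x : F p) : ∑ h, β p (m+1) x h = a p (m+1) * ∑ h, x h := by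
  by_cases hm : Odd (m+1)
  · have := sumβ1 x
    simp only [β, odd_one, if_true] at this
    simp [β, a, hm, this]
  · simp only [β, a, hm, if_false, N'_apply]
    rw [Fintype.sum_prod_type_right, Fintype.sum_prod_type]
    simp

theorem co_d {n : ℕ} (f : X p n ⟶ Tr p) (j : ℕ) (hj : j ≤ n + 1) :
    co (d p n ≫ f) j = a p j * co f (j-1) + (-1)^j * a p (n+1-j) * co f j := by
  have h1 : co (d p n ≫ f) j = f.hom (dl p n (gen (n+1) ⟨j, by omega⟩)) := by
    rw [co, dif_pos (by omega)]; rfl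
  rw [h1, hom_apply]
  have h2 : ∀ i : Fin (n+1), (∑ h, dl p n (gen (n+1) ⟨j, by omega⟩) i h) * co f i =
      (fun i : ℕ => (if i + 1 = j then a p (i+1) * co f i else 0) +
        (if i = j then (-1)^i * a p (n+1-i) * co f i else 0)) i := by
    intro i
    have e : n + 1 - i = (n - i) + 1 := by have := i.2; omega
    simp only [dl_apply, Pi.add_apply, Pi.smul_apply, Finset.sum_add_distrib, ← Finset.smul_sum]
    rw [e, sumα, sumβ, gen_sum, gen_sum]
    simp only [Fin.ext_iff, Fin.val_succ, Fin.val_castSucc, smul_eq_mul]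
    split <;> split <;> ring
  rw [Finset.sum_congr rfl (fun i _ => h2 i)]
  refine (Fin.sum_univ_eq_sum_range (fun i : ℕ => (if i + 1 = j then a p (i+1) * co f i else 0) +
        (if i = j then (-1)^i * a p (n+1-i) * co f i else 0)) (n+1)).trans ?_
  rw [Finset.sum_add_distrib]
  congr 1
  · cases j with
    | zero => simp [a]
    | succ j =>
      simp only [Nat.add_right_cancel_iff, Finset.sum_ite_eq', Finset.mem_range]
      rw [if_pos (by omega)]; simp
  · rw [Finset.sum_ite_eq']
    split
    · rfl
    · rename_i h
      have : n + 1 - j = 0 := by simp at h; omega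
      simp [this, a]

theorem co_add {n : ℕ} (f g : X p n ⟶ Tr p) (j) : co (f + g) j = co f j + co g j := by
  unfold co; split
  · rfl
  · simp
theorem co_smul {n : ℕ} (r : ℤ) (f : X p n ⟶ Tr p) (j) : co (r • f) j = r * co f j := by
  unfold co; split
  · rfl
  · simp

theorem a_odd (j) : a p (2*j+1) = 0 := by simp [a]
theorem a_even (j) : a p (2*j+2) = p := by
  have : ¬ Odd (2*j+2) := by rw [Nat.not_odd_iff_even]; exact ⟨j+1, by ring⟩
  simp [a, this]

/-- cocycle conditions -/
theorem cocycle_iff {k : ℕ} (f : X p (2*k+1) ⟶ Tr p) :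
    d p (2*k+1) ≫ f = 0 ↔
      co f 0 = 0 ∧ co f (2*k+1) = 0 ∧ ∀ b, b < k → co f (2*b+1) = - co f (2*b+2) := by
  have hp : (p : ℤ) ≠ 0 := by exact_mod_cast NeZero.ne p
  have h0 : ∀ j, co (0 : X p (2*k+1+1) ⟶ Tr p) j = 0 := by
    intro j; unfold co; split <;> rfl
  constructor
  · intro h
    have key : ∀ j, j ≤ 2*k+2 → 
        a p j * co f (j-1) + (-1)^j * a p (2*k+2-j) * co f j = 0 := fun j hj => by
      have := co_d f j hj
      rw [h, h0] at this
      exact this.symm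
    refine ⟨?_, ?_, fun b hb => ?_⟩
    · have := key 0 (by omega)
      rw [show 2*k+2-0 = 2*k+2 from rfl, a_even] at this
      simpa [a, hp, NeZero.ne p] using this
    · have := key (2*k+2) (by omega)
      rw [a_even] at this
      simpa [a, hp, NeZero.ne p] using this
    · have := key (2*b+2) (by omega)
      have e : 2*k+2-(2*b+2) = 2*(k-b-1)+2 := by omega
      rw [e, a_even, a_even, Even.neg_one_pow ⟨b+1, by ring⟩] at this
      have h3 : (p:ℤ) * (co f (2*b+1) + co f (2*b+2)) = 0 := by
        rw [← this]; simp; ring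
      have := (mul_eq_zero.1 h3).resolve_left hp
      linarith
  · rintro ⟨h1, h2, h3⟩
    refine hom_ext_co _ _ fun j hj => ?_
    rw [co_d _ _ hj, h0]
    rcases Nat.even_or_odd' j with ⟨b, rfl | rfl⟩
    · rcases Nat.eq_zero_or_pos b with rfl | hb
      · simp [h1, a]
      · obtain ⟨b, rfl⟩ : ∃ c, b = c + 1 := ⟨b-1, by omega⟩
        rcases Nat.lt_or_ge b k with hbk | hbk
        · have e : 2*k+1+1-2*(b+1) = 2*(k-b-1)+2 := by omega
          rw [e, show 2*(b+1) = 2*b+2 by ring, a_even, a_even, Even.neg_one_pow ⟨b+1, by ring⟩]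
          simp [h3 b hbk]
        · obtain rfl : b = k := by omega
          have e : 2*b+1+1-2*(b+1) = 0 := by omega
          rw [e, show 2*(b+1)-1 = 2*b+1 by omega, h2]; simp [a]
    · have e : 2*k+1+1-(2*b+1) = 2*(k-b)+1 := by omega
      rw [e, a_odd, a_odd]; simp

theorem cobdry_iff {k : ℕ} (f : X p (2*k+1) ⟶ Tr p) (hf : d p (2*k+1) ≫ f = 0) :
    (∃ g : X p (2*k) ⟶ Tr p, d p (2*k) ≫ g = f) ↔
      ∀ b, b < k → (p : ℤ) ∣ co f (2*b+2) := by
  obtain ⟨h1, h2, h3⟩ := (cocycle_iff f).1 hf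
  constructor
  · rintro ⟨g, rfl⟩ b hb
    rw [co_d _ _ (by omega), show 2*k+1-(2*b+2) = 2*(k-b-1)+1 by omega, a_odd, a_even]
    simp
  · intro h
    choose c hc using h
    let c' : ℕ → ℤ := fun j => if h : Odd j ∧ (j-1)/2 < k then c ((j-1)/2) h.2 else 0
    have hc' : ∀ b (hb : b < k), c' (2*b+1) = c b hb := by
      intro b hb
      have e : (2*b+1-1)/2 = b := by omega
      have : Odd (2*b+1) ∧ (2*b+1-1)/2 < k := ⟨⟨b, rfl⟩, by omega⟩
      simp only [c', dif_pos this]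
      congr 1
    refine ⟨hm (2*k) c', hom_ext_co _ _ fun j hj => ?_⟩
    rw [co_d _ _ hj]
    rcases Nat.even_or_odd' j with ⟨b, rfl | rfl⟩
    · have e : 2*k+1-2*b = 2*(k-b)+1 := by omega
      rw [e, a_odd]
      rcases Nat.eq_zero_or_pos b with rfl | hb
      · simp [h1, a]
      · obtain ⟨b, rfl⟩ : ∃ c, b = c + 1 := ⟨b-1, by omega⟩
        rw [show 2*(b+1) = 2*b+2 by ring, a_even, hc b (by omega), co_hm _ _ (by omega)]
        simp [hc' b (by omega)]
    · rw [a_odd]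
      rcases Nat.lt_or_ge b k with hbk | hbk
      · have e : 2*k+1-(2*b+1) = 2*(k-b-1)+2 := by omega
        rw [e, a_even, co_hm c' (2*b+1) (by omega), hc' b hbk, h3 b hbk, hc b hbk,
          Odd.neg_one_pow ⟨b, rfl⟩]; ring
      · obtain rfl : b = k := by omega
        rw [h2]; simp [a]

variable (p) in
noncomputable abbrev K : CochainComplex (ModuleCat ℤ) ℕ := (res p).complex.linearYonedaObj ℤ (Tr p)

theorem Kd (n : ℕ) (f : X p n ⟶ Tr p) : ((K p).d n (n+1)).hom f = d p n ≫ f := by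
  have : ((K p).d n (n+1)).hom f = (cx p).d (n+1) n ≫ f := rfl
  rw [this, cx_d]; rfl

variable (p) in
noncomputable def phi0 (k : ℕ) : (X p (2*k+1) ⟶ Tr p) →+ (Fin k → ZMod p) where
  toFun f b := (co f (2*b+2) : ZMod p)
  map_zero' := by
    ext b
    have : co (0 : X p (2*k+1) ⟶ Tr p) (2*b+2) = 0 := by unfold co; split <;> rfl
    simp [this]
  map_add' f g := by ext b; simp [co_add]

theorem hom_eq {R : Type} [CommRing R] (S : ShortComplex (ModuleCat.{0} R)) {W : Type}
    [AddCommGroup W] (φ : S.X₂ →+ W)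
    (hsurj : ∀ w, ∃ x, S.g.hom x = 0 ∧ φ x = w)
    (hker : ∀ x, S.g.hom x = 0 → (φ x = 0 ↔ ∃ y, S.f.hom y = x)) :
    Nonempty (S.homology ≃+ W) := by
  let π := (LinearMap.range S.moduleCatToCycles).mkQ.toAddMonoidHom
  let ψ : LinearMap.ker S.g.hom →+ W := φ.comp (LinearMap.ker S.g.hom).subtype.toAddMonoidHom
  have hπ : Function.Surjective π := Submodule.mkQ_surjective _
  have hψ : Function.Surjective ψ := fun w => by
    obtain ⟨x, hx, h⟩ := hsurj w
    exact ⟨⟨x, hx⟩, h⟩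
  have h : π.ker = ψ.ker := by
    ext ⟨x, hx⟩
    have h1 : (⟨x, hx⟩ : LinearMap.ker S.g.hom) ∈ π.ker ↔
        (⟨x, hx⟩ : LinearMap.ker S.g.hom) ∈ LinearMap.range S.moduleCatToCycles :=
      Submodule.Quotient.mk_eq_zero _
    rw [h1]
    refine Iff.trans ?_ (hker x hx).symm
    constructor
    · rintro ⟨g, hg⟩
      exact ⟨g, congrArg Subtype.val hg⟩
    · rintro ⟨g, hg⟩
      exact ⟨g, Subtype.ext hg⟩
  exact ⟨S.moduleCatHomologyIso.toLinearEquiv.toAddEquiv.trans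
    ((QuotientAddGroup.quotientKerEquivOfSurjective π hπ).symm.trans
      ((QuotientAddGroup.quotientAddEquivOfEq h).trans
        (QuotientAddGroup.quotientKerEquivOfSurjective ψ hψ)))⟩

theorem final (k : ℕ) : Nonempty ((K p).homology (2*k+1) ≃+ (Fin k → ZMod p)) := by
  let e1 : (K p).homology (2*k+1) ≅ ((K p).sc' (2*k) (2*k+1) (2*k+2)).homology :=
    ShortComplex.homologyMapIso ((K p).isoSc' (2*k) (2*k+1) (2*k+2) (by simp) (by simp))
  suffices h : Nonempty (((K p).sc' (2*k) (2*k+1) (2*k+2)).homology ≃+ (Fin k → ZMod p)) by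
    obtain ⟨e⟩ := h
    exact ⟨e1.toLinearEquiv.toAddEquiv.trans e⟩
  refine hom_eq _ (phi0 p k) ?_ ?_
  · intro v
    let c : ℕ → ℤ := fun j => if h : j = 0 then 0 else if h : (j-1)/2 < k then 
      (-1)^j * (v ⟨(j-1)/2, h⟩).val else 0
    have hc1 : ∀ b (hb : b < k), c (2*b+1) = -((v ⟨b, hb⟩).val : ℤ) := by
      intro b hb
      have e : (2*b+1-1)/2 = b := by omega
      simp only [c, e, hb, dif_pos]
      rw [dif_neg (by omega), Odd.neg_one_pow ⟨b, rfl⟩]; ring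
    have hc2 : ∀ b (hb : b < k), c (2*b+2) = ((v ⟨b, hb⟩).val : ℤ) := by
      intro b hb
      have e : (2*b+2-1)/2 = b := by omega
      simp only [c, e, hb, dif_pos]
      rw [dif_neg (by omega), Even.neg_one_pow ⟨b+1, by ring⟩]; ring
    have hcyc : d p (2*k+1) ≫ hm (p := p) (2*k+1) c = 0 := by
      rw [cocycle_iff]
      refine ⟨?_, ?_, fun b hb => ?_⟩
      · rw [co_hm _ _ (by omega)]; simp [c]
      · rw [co_hm _ _ (by omega)]; simp [c]
      · rw [co_hm _ _ (by omega), co_hm _ _ (by omega), hc1 b hb, hc2 b hb]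
    refine ⟨hm (p := p) (2*k+1) c, (Kd (2*k+1) _).trans hcyc, ?_⟩
    ext b
    change ((co (hm (p := p) (2*k+1) c) (2*b+2) : ℤ) : ZMod p) = v b
    rw [co_hm _ _ (by have := b.2; omega), hc2 b b.2]
    simp
  · intro f hf
    have hf' : d p (2*k+1) ≫ f = 0 := (Kd (2*k+1) f).symm.trans hf
    have h1 : phi0 p k f = 0 ↔ ∀ b, b < k → (p : ℤ) ∣ co (p := p) f (2*b+2) := by
      constructor
      · intro h b hb
        have := congrFun h ⟨b, hb⟩
        exact (ZMod.intCast_zmod_eq_zero_iff_dvd _ _).1 this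
      · intro h
        ext b
        exact (ZMod.intCast_zmod_eq_zero_iff_dvd _ _).2 (h b b.2)
    refine h1.trans ((cobdry_iff f hf').symm.trans ?_)
    constructor
    · rintro ⟨g, hg⟩
      exact ⟨g, (Kd (2*k) g).trans hg⟩
    · rintro ⟨g, hg⟩
      exact ⟨g, (Kd (2*k) g).symm.trans hg⟩

end coh
end ZpZp

/-- For `p` an odd prime and `k ≥ 1`, the group cohomology of `ℤ/p × ℤ/p` in degree
`2k+1` with coefficients in the trivial module `ℤ` is isomorphic to `(ℤ/p)^k`. -/
theorem group_cohomology_zpzp_odd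
    (p : ℕ) [Fact p.Prime] (hodd : Odd p) (k : ℕ) (hk : 1 ≤ k) :
    Nonempty
      ((groupCohomology
          (Rep.trivial ℤ (Multiplicative (ZMod p × ZMod p)) ℤ) (2 * k + 1)) ≃+
        (Fin k → ZMod p)) := by
  obtain ⟨e⟩ := ZpZp.final (p := p) k
  exact ⟨(groupCohomologyIso _ _ (ZpZp.res p)).toLinearEquiv.toAddEquiv.trans e⟩
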